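/- Suppose every utility function u_i is continuous, semi-strictly quasi-concave, and strictly increasing. Then there exists a pseudo-market equilibrium (x*, p*) such that x* is 𝒞-constrained Pareto efficient. -/

import Mathlib

open Finset

noncomputable def dotO {O : Type*} [Fintype O] (p z : O → ℝ) : ℝ := ∑ l, p l * z l

noncomputable def dotIO {I O : Type*} [Fintype I] [Fintype O] (a x : I → O → ℝ) : ℝ :=
  ∑ i, ∑ l, a i l * x i l

noncomputable def pers {I O C : Type*} [Fintype C] (a : C → I → O → ℝ) (p : C → ℝ)
    (i : I) : O → ℝ :=
  fun l => ∑ c, a c i l * p c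

/-- No element lies, for every index `i`, strictly `r i`-above some member of `A`
(Scarf's primitive sets). -/
def IsDominant {I T : Type*} (r : I → T → ℕ) (A : Finset T) : Prop :=
  ∀ y, ∃ i, ∀ x ∈ A, r i y ≤ r i x

open Classical in
theorem even_card_insert_isDominant {I T : Type*} [Fintype I] [Fintype T]
    (r : I → T → ℕ) (hr : ∀ i, Function.Injective (r i)) (D : Finset T)
    (hD : D.card + 1 = Fintype.card I) (t₀ : T) (ht₀ : t₀ ∈ D) (s : I → T)
    (hs : ∀ k i, k ≠ i → r k t₀ < r k (s i)) :
    Even (univ.filter fun y => y ∉ D ∧ IsDominant r (insert y D)).card := by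
  by_cases hdom : IsDominant r D
  swap
  · have : (univ.filter fun y => y ∉ D ∧ IsDominant r (insert y D)) = ∅ := by
      refine Finset.filter_eq_empty_iff.2 fun y _ hy => hdom fun z => ?_
      obtain ⟨i, hi⟩ := hy.2 z
      exact ⟨i, fun x hx => hi x (Finset.mem_insert_of_mem hx)⟩
    simp [this]
  choose m hmD hm using fun i => Finset.exists_min_image D (r i) ⟨t₀, ht₀⟩
  have surj : ∀ x ∈ D, ∃ i, m i = x := fun x hx => by
    obtain ⟨i, hi⟩ := hdom x
    exact ⟨i, hr i (le_antisymm (hm i x hx) (hi _ (hmD i)))⟩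
  obtain ⟨i₁, -, i₂, -, hne, hcol⟩ := Finset.exists_ne_map_eq_of_card_lt_of_maps_to
    (s := (univ : Finset I)) (t := D) (f := m) (by rw [Finset.card_univ]; omega)
    (fun i _ => hmD i)
  have inj : ∀ i, (∀ x ∈ D, ∃ k, k ≠ i ∧ m k = x) →
      Set.InjOn m ((univ.erase i : Finset I) : Set I) := fun i h => by
    refine Finset.injOn_of_surjOn_of_card_le (t := D) m (fun k _ => hmD k) (fun x hx => ?_) ?_
    · obtain ⟨k, hk, rfl⟩ := h x hx
      exact ⟨k, by simpa using hk, rfl⟩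
    · rw [Finset.card_erase_of_mem (Finset.mem_univ _), Finset.card_univ]; omega
  have surj' : ∀ i, i = i₁ ∨ i = i₂ → ∀ x ∈ D, ∃ k, k ≠ i ∧ m k = x := by
    intro i hi x hx
    obtain ⟨k, rfl⟩ := surj x hx
    by_cases hk : k = i
    · rcases hi with rfl | rfl
      · exact ⟨i₂, hne.symm, by rw [hk, hcol]⟩
      · exact ⟨i₁, hne, by rw [hk, hcol]⟩
    · exact ⟨k, hk, rfl⟩
  set Q : I → T → Prop := fun i y => (∀ k, k ≠ i → r k (m k) < r k y) ∧
    ∀ z, (∀ k, k ≠ i → r k (m k) < r k z) → r i z ≤ r i y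
  have exQ : ∀ i, ∃ y, Q i y := fun i => by
    obtain ⟨y, hy, hmax⟩ := Finset.exists_max_image
      (univ.filter fun y => ∀ k, k ≠ i → r k (m k) < r k y) (r i)
      ⟨s i, by
        simp only [Finset.mem_filter, Finset.mem_univ, true_and]
        exact fun k hk => (hm k _ ht₀).trans_lt (hs k i hk)⟩
    simp only [Finset.mem_filter, Finset.mem_univ, true_and] at hy hmax
    exact ⟨y, hy, hmax⟩
  have uniqQ : ∀ i y z, Q i y → Q i z → y = z := fun i y z hy hz =>
    hr i (le_antisymm (hz.2 y hy.1) (hy.2 z hz.1))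
  have char : ∀ y, (y ∉ D ∧ IsDominant r (insert y D)) ↔ (Q i₁ y ∨ Q i₂ y) := by
    intro y
    constructor
    · rintro ⟨hyD, hy⟩
      obtain ⟨i, hi⟩ := hy y
      have hlt : r i y < r i (m i) := lt_of_le_of_ne
        (hi _ (Finset.mem_insert_of_mem (hmD i)))
        fun h => hyD (by rw [hr i h]; exact hmD i)
      have h1 : ∀ x ∈ D, ∃ k, (k ≠ i ∧ m k = x) ∧ r k (m k) < r k y := by
        intro x hx
        obtain ⟨k, hk⟩ := hy x
        have hmk : m k = x := hr k (le_antisymm (hm k x hx)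
          (hk _ (Finset.mem_insert_of_mem (hmD k))))
        refine ⟨k, ⟨?_, hmk⟩, ?_⟩
        · rintro rfl
          have := hk y (Finset.mem_insert_self _ _)
          have := hm k x hx
          omega
        · rw [hmk]
          refine lt_of_le_of_ne (hk y (Finset.mem_insert_self _ _)) fun h => hyD ?_
          rw [← hr k h]; exact hx
      have hinj := inj i fun x hx => (h1 x hx).imp fun k hk => hk.1
      have hi12 : i = i₁ ∨ i = i₂ := by
        by_contra! h
        exact hne (hinj (by simpa using h.1.symm) (by simpa using h.2.symm) hcol)
      have hQi : Q i y := by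
        refine ⟨fun k hk => ?_, fun z hz => ?_⟩
        · obtain ⟨k', ⟨hk', he⟩, hlt'⟩ := h1 (m k) (hmD k)
          have : k' = k := hinj (by simpa using hk') (by simpa using hk) he
          rwa [this] at hlt'
        · obtain ⟨k, hk⟩ := hy z
          by_cases hki : k = i
          · subst hki; exact hk y (Finset.mem_insert_self _ _)
          · exact absurd (hz k hki) (not_lt.2 (hk _ (Finset.mem_insert_of_mem (hmD k))))
      rcases hi12 with rfl | rfl
      · exact Or.inl hQi
      · exact Or.inr hQi
    · intro h
      obtain ⟨i, hi, hQi⟩ : ∃ i, (i = i₁ ∨ i = i₂) ∧ Q i y := by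
        rcases h with h | h
        · exact ⟨i₁, Or.inl rfl, h⟩
        · exact ⟨i₂, Or.inr rfl, h⟩
      refine ⟨fun hyD => ?_, fun z => ?_⟩
      · obtain ⟨k, hk, rfl⟩ := surj' i hi y hyD
        exact lt_irrefl _ (hQi.1 k hk)
      · by_cases hz : ∀ k, k ≠ i → r k (m k) < r k z
        · obtain ⟨k, hk⟩ := hdom z
          have hki : k = i := by
            by_contra hki
            exact absurd (hz k hki) (not_lt.2 (hk _ (hmD k)))
          subst hki
          refine ⟨k, fun x hx => ?_⟩
          rcases Finset.mem_insert.1 hx with rfl | hx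
          · exact hQi.2 z hz
          · exact hk x hx
        · push Not at hz
          obtain ⟨k, hki, hk⟩ := hz
          refine ⟨k, fun x hx => ?_⟩
          rcases Finset.mem_insert.1 hx with rfl | hx
          · exact hk.trans (hQi.1 k hki).le
          · exact hk.trans (hm k x hx)
  obtain ⟨y₁, h₁⟩ := exQ i₁
  obtain ⟨y₂, h₂⟩ := exQ i₂
  have hy : y₁ ≠ y₂ := by
    rintro rfl
    obtain ⟨k, hk⟩ := hdom y₁
    have h := hk _ (hmD k)
    by_cases hk1 : k = i₁
    · exact absurd (h₂.1 k (by rw [hk1]; exact hne)) (not_lt.2 h)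
    · exact absurd (h₁.1 k hk1) (not_lt.2 h)
  have : (univ.filter fun y => y ∉ D ∧ IsDominant r (insert y D)) = {y₁, y₂} := by
    ext y
    simp only [Finset.mem_filter, Finset.mem_univ, true_and, Finset.mem_insert,
      Finset.mem_singleton, char]
    constructor
    · rintro (h | h)
      · exact Or.inl (uniqQ _ _ _ h h₁)
      · exact Or.inr (uniqQ _ _ _ h h₂)
    · rintro (rfl | rfl)
      · exact Or.inl h₁
      · exact Or.inr h₂
  rw [this, Finset.card_pair hy]
  exact even_two

open Classical in
theorem card_insert_isDominant_slack {I T : Type*} [Fintype I] [Fintype T]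
    (r : I → T → ℕ) (hr : ∀ i, Function.Injective (r i)) (s : I → T)
    (hs_min : ∀ i t, t ≠ s i → r i (s i) < r i t)
    (hs_max : ∀ i j t, i ≠ j → t ∉ Set.range s → r i t < r i (s j))
    (t₀ : T) (ht₀ : t₀ ∉ Set.range s) (i₀ : I) :
    (univ.filter fun y => y ∉ (univ.erase i₀).image s ∧
      IsDominant r (insert y ((univ.erase i₀).image s))).card = 1 := by
  obtain ⟨y, hy, hmax⟩ := Finset.exists_max_image
    (univ.filter fun t => t ∉ Set.range s) (r i₀) ⟨t₀, by simpa using ht₀⟩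
  simp only [Finset.mem_filter, Finset.mem_univ, true_and] at hy hmax
  rw [Finset.card_eq_one]
  refine ⟨y, ?_⟩
  ext z
  simp only [Finset.mem_filter, Finset.mem_univ, true_and, Finset.mem_singleton]
  constructor
  · rintro ⟨hzD, hz⟩
    have hmem : ∀ i, i ≠ i₀ → s i ∈ insert z ((univ.erase i₀).image s) := fun i hi =>
      Finset.mem_insert_of_mem (Finset.mem_image_of_mem _ (by simpa using hi))
    have key : ∀ t, t ∉ Set.range s → r i₀ t ≤ r i₀ z := fun t ht => by
      obtain ⟨i, hi⟩ := hz t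
      by_cases h : i = i₀
      · subst h; exact hi z (Finset.mem_insert_self _ _)
      · exact absurd (hs_min i t fun e => ht ⟨i, e.symm⟩) (not_lt.2 (hi _ (hmem i h)))
    have hzs : z ∉ Set.range s := by
      rintro ⟨j, rfl⟩
      have hj : j = i₀ := by
        by_contra hj
        exact hzD (Finset.mem_image_of_mem _ (by simpa using hj))
      subst hj
      exact absurd (hs_min j t₀ fun e => ht₀ ⟨j, e.symm⟩) (not_lt.2 (key t₀ ht₀))
    exact hr i₀ (le_antisymm (hmax z hzs) (key y hy))
  · rintro rfl
    refine ⟨fun h => ?_, fun t => ?_⟩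
    · obtain ⟨i, -, hi⟩ := Finset.mem_image.1 h
      exact hy ⟨i, hi⟩
    · by_cases ht : t ∈ Set.range s
      · obtain ⟨j, rfl⟩ := ht
        refine ⟨j, fun x _ => ?_⟩
        by_cases hx : x = s j
        · rw [hx]
        · exact (hs_min j x hx).le
      · refine ⟨i₀, fun x hx => ?_⟩
        rcases Finset.mem_insert.1 hx with rfl | hx
        · exact hmax t ht
        · obtain ⟨j, hj, rfl⟩ := Finset.mem_image.1 hx
          exact (hs_max i₀ j t (Finset.ne_of_mem_erase hj).symm ht).le

open Classical in
theorem even_card_erase_image_eq {I T : Type*} [Fintype I]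
    (c : T → I) (i₀ : I) (A : Finset T) (hA : A.card = Fintype.card I)
    (hc : A.image c ≠ univ) :
    Even (A.filter fun a => (A.erase a).image c = univ.erase i₀).card := by
  by_cases hne : ∃ a ∈ A, (A.erase a).image c = univ.erase i₀
  swap
  · push Not at hne
    rw [Finset.filter_eq_empty_iff.2 hne]; simp
  obtain ⟨a, ha, hac⟩ := hne
  have hinj : Set.InjOn c (A.erase a : Finset T) := by
    refine Finset.injOn_of_card_image_eq ?_
    rw [hac, Finset.card_erase_of_mem ha, Finset.card_erase_of_mem (Finset.mem_univ _), hA,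
      Finset.card_univ]
  have hins : A.image c = insert (c a) (univ.erase i₀) := by
    rw [← hac, ← Finset.image_insert, Finset.insert_erase ha]
  have hca : c a ≠ i₀ := by
    intro h
    apply hc
    rw [hins, h, Finset.insert_erase (Finset.mem_univ _)]
  obtain ⟨a', ha', hcc⟩ : ∃ a' ∈ A.erase a, c a' = c a := by
    have : c a ∈ (A.erase a).image c := by rw [hac]; simpa using hca
    simpa using Finset.mem_image.1 this
  have haa : a' ≠ a := Finset.ne_of_mem_erase ha'
  have : (A.filter fun a => (A.erase a).image c = univ.erase i₀) = {a, a'} := by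
    ext b
    simp only [Finset.mem_filter, Finset.mem_insert, Finset.mem_singleton]
    constructor
    · rintro ⟨hbA, hb⟩
      by_contra! hn
      have hcb : c b ∈ (A.erase b).image c := by
        rw [hb, ← hac]
        exact Finset.mem_image_of_mem _ (Finset.mem_erase.2 ⟨hn.1, hbA⟩)
      obtain ⟨d, hd, hdb⟩ := Finset.mem_image.1 hcb
      have hbe : b ∈ (A.erase a : Finset T) := Finset.mem_erase.2 ⟨hn.1, hbA⟩
      by_cases hda : d = a
      · subst hda
        exact hn.2 (hinj hbe ha' (by rw [hcc, hdb]))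
      · exact (Finset.ne_of_mem_erase hd)
          (hinj (Finset.mem_erase.2 ⟨hda, Finset.mem_of_mem_erase hd⟩) hbe hdb)
    · rintro (rfl | rfl)
      · exact ⟨ha, hac⟩
      · refine ⟨Finset.mem_of_mem_erase ha', ?_⟩
        rw [← hac]
        ext j
        simp only [Finset.mem_image, Finset.mem_erase]
        constructor
        · rintro ⟨d, ⟨hd, hdA⟩, rfl⟩
          by_cases hda : d = a
          · exact ⟨b, ⟨haa, Finset.mem_of_mem_erase ha'⟩, by rw [hda, hcc]⟩
          · exact ⟨d, ⟨hda, hdA⟩, rfl⟩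
        · rintro ⟨d, ⟨hd, hdA⟩, rfl⟩
          by_cases hda : d = b
          · exact ⟨a, ⟨haa.symm, ha⟩, by rw [hda, hcc]⟩
          · exact ⟨d, ⟨hda, hdA⟩, rfl⟩
  rw [this, Finset.card_pair haa.symm]
  exact even_two

open Classical in
/-- Scarf's lemma: some dominant set carries all colours exactly once. -/
theorem exists_isDominant_image_eq_univ {I T : Type*} [Fintype I] [Nontrivial I] [Fintype T]
    (r : I → T → ℕ) (hr : ∀ i, Function.Injective (r i)) (s : I → T)
    (hs_min : ∀ i t, t ≠ s i → r i (s i) < r i t)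
    (hs_max : ∀ i j t, i ≠ j → t ∉ Set.range s → r i t < r i (s j))
    (t₀ : T) (ht₀ : t₀ ∉ Set.range s) (c : T → I) (hcs : ∀ i, c (s i) = i) :
    ∃ A : Finset T, A.card = Fintype.card I ∧ A.image c = univ ∧ IsDominant r A := by
  by_contra! hcon
  obtain ⟨i₀⟩ : Nonempty I := inferInstance
  have hI : 1 < Fintype.card I := Fintype.one_lt_card
  have hsinj : Function.Injective s := Function.LeftInverse.injective hcs
  let door : Finset T → Prop := fun D => D.card + 1 = Fintype.card I ∧ D.image c = univ.erase i₀
  let room : Finset T → Prop := fun A => A.card = Fintype.card I ∧ IsDominant r A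
  let P : Finset (Finset T × T) := univ.filter fun x => x.2 ∈ x.1 ∧ room x.1 ∧ door (x.1.erase x.2)
  let Q : Finset (Finset T × T) :=
    univ.filter fun x => x.2 ∉ x.1 ∧ door x.1 ∧ room (insert x.2 x.1)
  have hPQ : P.card = Q.card := by
    refine Finset.card_nbij' (fun x => (x.1.erase x.2, x.2)) (fun x => (insert x.2 x.1, x.2))
      ?_ ?_ ?_ ?_
    · rintro ⟨A, a⟩ h
      simp only [P, Q, Finset.coe_filter, Finset.mem_univ, true_and, Set.mem_ofPred_eq] at h ⊢
      exact ⟨Finset.notMem_erase _ _, h.2.2, by rw [Finset.insert_erase h.1]; exact h.2.1⟩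
    · rintro ⟨A, a⟩ h
      simp only [P, Q, Finset.coe_filter, Finset.mem_univ, true_and, Set.mem_ofPred_eq] at h ⊢
      exact ⟨Finset.mem_insert_self _ _, h.2.2, by rw [Finset.erase_insert h.1]; exact h.2.1⟩
    · rintro ⟨A, a⟩ h
      simp only [P, Finset.coe_filter, Finset.mem_univ, true_and, Set.mem_ofPred_eq] at h
      simp [Finset.insert_erase h.1]
    · rintro ⟨A, a⟩ h
      simp only [Q, Finset.coe_filter, Finset.mem_univ, true_and, Set.mem_ofPred_eq] at h
      simp [Finset.erase_insert h.1]
  have hP : Even P.card := by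
    rw [Finset.card_eq_sum_card_fiberwise (f := Prod.fst) (t := univ) (fun _ _ => by simp)]
    refine Finset.even_sum _ fun A _ => ?_
    by_cases hA : room A
    · have he := even_card_erase_image_eq c i₀ A hA.1 fun h => hcon A hA.1 h hA.2
      rw [show (P.filter fun x => x.1 = A).card =
        (A.filter fun a => (A.erase a).image c = univ.erase i₀).card from ?_]
      · exact he
      refine Finset.card_nbij' Prod.snd (fun a => (A, a)) ?_ ?_ ?_ ?_
      · rintro ⟨B, a⟩ h
        simp only [P, Finset.coe_filter, Finset.mem_filter, Finset.mem_univ, true_and,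
          Set.mem_ofPred_eq] at h ⊢
        obtain ⟨⟨h1, h2, h3⟩, rfl⟩ := h
        exact ⟨h1, h3.2⟩
      · rintro a h
        simp only [P, Finset.coe_filter, Finset.mem_filter, Finset.mem_univ, true_and,
          Set.mem_ofPred_eq, and_true] at h ⊢
        refine ⟨h.1, hA, ?_, h.2⟩
        rw [Finset.card_erase_of_mem h.1, hA.1]; omega
      · rintro ⟨B, a⟩ h
        simp only [Finset.coe_filter, Set.mem_ofPred_eq] at h
        simp [h.2]
      · intro a _; rfl
    · rw [Finset.filter_eq_empty_iff.2]
      · simp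
      · rintro ⟨B, a⟩ h
        simp only [P, Finset.mem_filter, Finset.mem_univ, true_and] at h ⊢
        rintro rfl
        exact hA h.2.1
  have fib : ∀ D, door D → (Q.filter fun x => x.1 = D).card =
      (univ.filter fun y => y ∉ D ∧ IsDominant r (insert y D)).card := by
    intro D hD
    refine Finset.card_nbij' Prod.snd (fun a => (D, a)) ?_ ?_ ?_ ?_
    · rintro ⟨B, a⟩ h
      simp only [Q, Finset.coe_filter, Finset.mem_filter, Finset.mem_univ, true_and,
        Set.mem_ofPred_eq] at h ⊢
      obtain ⟨⟨h1, h2, h3⟩, rfl⟩ := h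
      exact ⟨h1, h3.2⟩
    · rintro a h
      simp only [Q, Finset.coe_filter, Finset.mem_filter, Finset.mem_univ, true_and,
        Set.mem_ofPred_eq, and_true] at h ⊢
      exact ⟨h.1, hD, by rw [Finset.card_insert_of_notMem h.1, hD.1], h.2⟩
    · rintro ⟨B, a⟩ h
      simp only [Finset.coe_filter, Set.mem_ofPred_eq] at h
      simp [h.2]
    · intro a _; rfl
  have hQ : Odd Q.card := by
    rw [Finset.card_eq_sum_card_fiberwise (f := Prod.fst) (t := univ) (fun _ _ => by simp),
      ← Finset.add_sum_erase _ _ (Finset.mem_univ ((univ.erase i₀).image s))]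
    have hD₀ : door ((univ.erase i₀).image s) := by
      constructor
      · rw [Finset.card_image_of_injective _ hsinj, Finset.card_erase_of_mem (Finset.mem_univ _),
          Finset.card_univ]
        omega
      · rw [Finset.image_image, show c ∘ s = id from funext hcs, Finset.image_id]
    rw [fib _ hD₀, card_insert_isDominant_slack r hr s hs_min hs_max t₀ ht₀ i₀]
    refine Odd.add_even odd_one (Finset.even_sum _ fun D hDne => ?_)
    by_cases hD : door D
    · rw [fib D hD]
      obtain ⟨t, htD, ht⟩ : ∃ t ∈ D, t ∉ Set.range s := by
        by_contra! h
        apply Finset.ne_of_mem_erase hDne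
        ext x
        constructor
        · intro hx
          obtain ⟨j, rfl⟩ := h x hx
          refine Finset.mem_image_of_mem _ ?_
          rw [← hD.2, ← hcs j]
          exact Finset.mem_image.2 ⟨s j, hx, by rw [hcs]⟩
        · intro hx
          obtain ⟨j, hj, rfl⟩ := Finset.mem_image.1 hx
          rw [← hD.2] at hj
          obtain ⟨d, hd, rfl⟩ := Finset.mem_image.1 hj
          obtain ⟨j, rfl⟩ := h d hd
          rwa [hcs]
      exact even_card_insert_isDominant r hr D hD.1 t htD s fun k i hk => hs_max k i t hk ht
    · rw [Finset.filter_eq_empty_iff.2]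
      · simp
      · rintro ⟨B, a⟩ h
        simp only [Q, Finset.mem_filter, Finset.mem_univ, true_and] at h ⊢
        rintro rfl
        exact hD h.2.1
  rw [hPQ] at hP
  exact (Nat.not_even_iff_odd.2 hQ) hP

open Classical in
/-- Scarf's lemma for weak orders given by integer ranks, without slack elements. -/
theorem exists_colored_dominant {I T : Type*} [Fintype I] [Nontrivial I] [Fintype T] [Nonempty T]
    (v : I → T → ℕ) (c : T → I) :
    ∃ σ : Finset T, σ.Nonempty ∧ ∀ y, ∃ x' ∈ σ, ∀ x ∈ σ, v (c x') y ≤ v (c x') x := by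
  set M := Fintype.card T with hM
  let e : T ≃ Fin M := Fintype.equivFin T
  let e' : I ≃ Fin (Fintype.card I) := Fintype.equivFin I
  obtain ⟨B, hB⟩ : ∃ B, ∀ i x, v i x * M + e x ≤ B := by
    refine ⟨∑ i, ∑ x, (v i x * M + e x), fun i x => ?_⟩
    exact (Finset.single_le_sum (f := fun x => v i x * M + (e x : ℕ))
      (fun _ _ => Nat.zero_le _) (Finset.mem_univ x)).trans
      (Finset.single_le_sum (f := fun i => ∑ x, (v i x * M + (e x : ℕ)))
      (fun _ _ => Nat.zero_le _) (Finset.mem_univ i))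
  let r : I → T ⊕ I → ℕ := fun i => Sum.elim (fun x => 1 + (v i x * M + e x))
    (fun j => if j = i then 0 else 2 + B + e' j)
  have lex : ∀ i x y, v i x * M + e x ≤ v i y * M + e y → v i x ≤ v i y := by
    intro i x y h
    by_contra! hlt
    have h1 : (v i y + 1) * M ≤ v i x * M := Nat.mul_le_mul_right _ hlt
    have h2 := (e y).2
    rw [Nat.add_mul] at h1
    omega
  have hr : ∀ i, Function.Injective (r i) := by
    rintro i (x | j) (y | k) h
    · simp only [r, Sum.elim_inl] at h
      have hv : v i x = v i y := le_antisymm (lex i x y (by omega)) (lex i y x (by omega))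
      rw [hv] at h
      exact congrArg _ (e.injective (Fin.ext (by omega)))
    · simp only [r, Sum.elim_inl, Sum.elim_inr] at h
      have := hB i x
      split_ifs at h <;> omega
    · simp only [r, Sum.elim_inl, Sum.elim_inr] at h
      have := hB i y
      split_ifs at h <;> omega
    · simp only [r, Sum.elim_inr] at h
      split_ifs at h with h1 h2 h2
      · rw [h1, h2]
      · omega
      · omega
      · exact congrArg _ (e'.injective (Fin.ext (by omega)))
  obtain ⟨t₀⟩ := ‹Nonempty T›
  obtain ⟨A, -, hAc, hA⟩ := exists_isDominant_image_eq_univ r hr Sum.inr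
    (by
      rintro i (x | j) h
      · simp [r]
      · have : j ≠ i := fun e => h (by rw [e])
        simp [r, this])
    (by
      rintro i j (x | k) hij h
      · have := hB i x
        simp only [r, Sum.elim_inl, Sum.elim_inr, if_neg hij.symm]
        omega
      · exact absurd ⟨k, rfl⟩ h)
    (Sum.inl t₀) (by simp) (Sum.elim c id) (by simp)
  have key : ∀ y, ∃ x', Sum.inl x' ∈ A ∧ ∀ x, Sum.inl x ∈ A → v (c x') y ≤ v (c x') x := by
    intro y
    obtain ⟨i, hi⟩ := hA (Sum.inl y)
    obtain ⟨a, haA, ha⟩ := Finset.mem_image.1 (hAc ▸ Finset.mem_univ i)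
    rcases a with x' | j
    · simp only [Sum.elim_inl] at ha
      refine ⟨x', haA, fun x hx => ?_⟩
      have := hi _ hx
      simp only [r, Sum.elim_inl] at this
      rw [ha]
      exact lex i y x (by omega)
    · simp only [Sum.elim_inr, id] at ha
      have := hi _ haA
      simp [r, ha] at this
  refine ⟨univ.filter fun x => Sum.inl x ∈ A, ?_, fun y => ?_⟩
  · obtain ⟨x', hx', -⟩ := key t₀
    exact ⟨x', by simpa using hx'⟩
  · obtain ⟨x', hx', h⟩ := key y
    exact ⟨x', by simpa using hx', fun x hx => h x (by simpa using hx)⟩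

theorem exists_approx_le_apply {ι : Type*} [Fintype ι] [Nontrivial ι] (f : (ι → ℝ) → ι → ℝ)
    (hf : Set.MapsTo f (stdSimplex ℝ ι) (stdSimplex ℝ ι)) (N : ℕ) (hN : 0 < N) :
    ∃ q ∈ stdSimplex ℝ ι, ∀ i, ∃ q' ∈ stdSimplex ℝ ι,
      (∀ j, |q' j - q j| ≤ Fintype.card ι / N) ∧ q' i - Fintype.card ι / N ≤ f q' i := by
  classical
  have hN' : (0 : ℝ) < N := by exact_mod_cast hN
  let T := {x : ι → Fin (N + 1) // ∑ i, (x i : ℕ) = N}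
  have mk : ∀ g : ι → ℕ, ∑ i, g i = N → ∃ y : T, ∀ i, (y.1 i : ℕ) = g i := fun g hg =>
    ⟨⟨fun i => ⟨g i, by
      have := Finset.single_le_sum (f := g) (fun _ _ => Nat.zero_le _) (Finset.mem_univ i)
      omega⟩, hg⟩, fun i => rfl⟩
  obtain ⟨i₀⟩ : Nonempty ι := inferInstance
  have : Nonempty T := (mk (Pi.single i₀ N) (by simp)).nonempty
  let P : T → ι → ℝ := fun x i => (x.1 i : ℕ) / (N : ℝ)
  have hP : ∀ x, P x ∈ stdSimplex ℝ ι := fun x => by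
    refine ⟨fun i => by positivity, ?_⟩
    simp only [P]
    rw [← Finset.sum_div, div_eq_one_iff_eq hN'.ne']
    exact_mod_cast x.2
  have hlab : ∀ x, ∃ i, P x i ≤ f (P x) i := fun x => by
    by_contra! h
    have := Finset.sum_lt_sum_of_nonempty ⟨i₀, Finset.mem_univ i₀⟩ fun i _ => h i
    rw [(hP x).2, (hf (hP x)).2] at this
    exact lt_irrefl _ this
  choose c hc using hlab
  obtain ⟨σ, hσ, hdom⟩ := exists_colored_dominant (fun i (x : T) => (x.1 i : ℕ)) c
  set J := σ.image c with hJ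
  choose w hwσ hw using fun i => Finset.exists_min_image σ (fun x : T => (x.1 i : ℕ)) hσ
  have hJsum : N < ∑ i ∈ J, (((w i).1 i : ℕ) + 1) := by
    by_contra! hle
    obtain ⟨x₀, hx₀⟩ := hσ
    have hj₀ : c x₀ ∈ J := Finset.mem_image_of_mem _ hx₀
    obtain ⟨y, hy⟩ := mk ((fun i => if i ∈ J then ((w i).1 i : ℕ) + 1 else 0) +
      Pi.single (c x₀) (N - ∑ i ∈ J, (((w i).1 i : ℕ) + 1))) (by
        simp only [Pi.add_apply, Finset.sum_add_distrib (s := univ), Finset.sum_ite_mem,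
          Finset.univ_inter, Finset.sum_pi_single', Finset.mem_univ, if_true]
        omega)
    obtain ⟨x', hx', h⟩ := hdom y
    have h1 := h _ (hwσ (c x'))
    rw [hy] at h1
    simp only [Pi.add_apply, hJ ▸ Finset.mem_image_of_mem c hx', if_true] at h1
    omega
  have hJcard : J.card ≤ Fintype.card ι := Finset.card_le_univ J
  rw [Finset.sum_add_distrib, Finset.sum_const, smul_eq_mul, mul_one] at hJsum
  have hmle : ∀ x ∈ σ, ∀ j ∈ J, ((w j).1 j : ℕ) ≤ (x.1 j : ℕ) := fun x hx j _ => hw j x hx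
  have hin : ∀ x ∈ σ, ∀ j ∈ J, (x.1 j : ℕ) ≤ (w j).1 j + Fintype.card ι := by
    intro x hx j hj
    have h1 : ∑ i ∈ J, (x.1 i : ℕ) ≤ N :=
      (Finset.sum_le_sum_of_subset (Finset.subset_univ _)).trans_eq x.2
    rw [← Finset.add_sum_erase _ _ hj] at h1 hJsum
    have h2 : ∑ i ∈ J.erase j, ((w i).1 i : ℕ) ≤ ∑ i ∈ J.erase j, (x.1 i : ℕ) :=
      Finset.sum_le_sum fun i hi => hmle x hx i (Finset.mem_of_mem_erase hi)
    omega
  have hout : ∀ x ∈ σ, ∀ j, j ∉ J → (x.1 j : ℕ) ≤ Fintype.card ι := by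
    intro x hx j hj
    have h1 : ∑ i ∈ insert j J, (x.1 i : ℕ) ≤ N :=
      (Finset.sum_le_sum_of_subset (Finset.subset_univ _)).trans_eq x.2
    rw [Finset.sum_insert hj] at h1
    have h2 : ∑ i ∈ J, ((w i).1 i : ℕ) ≤ ∑ i ∈ J, (x.1 i : ℕ) :=
      Finset.sum_le_sum fun i hi => hmle x hx i hi
    omega
  have hclose : ∀ x ∈ σ, ∀ x' ∈ σ, ∀ j, (x.1 j : ℕ) ≤ x'.1 j + Fintype.card ι := by
    intro x hx x' hx' j
    by_cases hj : j ∈ J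
    · have := hin x hx j hj
      have := hmle x' hx' j hj
      omega
    · have := hout x hx j hj
      omega
  have hclose' : ∀ x ∈ σ, ∀ x' ∈ σ, ∀ j, P x j - P x' j ≤ Fintype.card ι / N := by
    intro x hx x' hx' j
    simp only [P]
    rw [← sub_div]
    refine div_le_div_of_nonneg_right ?_ hN'.le
    rw [sub_le_iff_le_add']
    exact_mod_cast hclose x hx x' hx' j
  obtain ⟨x₀, hx₀⟩ := hσ
  refine ⟨P x₀, hP x₀, fun i => ?_⟩
  by_cases hi : i ∈ J
  · obtain ⟨x, hx, rfl⟩ := Finset.mem_image.1 hi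
    refine ⟨P x, hP x, fun j => abs_sub_le_iff.2
      ⟨hclose' x hx x₀ hx₀ j, hclose' x₀ hx₀ x hx j⟩, ?_⟩
    have : (0 : ℝ) ≤ Fintype.card ι / N := by positivity
    linarith [hc x]
  · refine ⟨P x₀, hP x₀, fun j => ?_, ?_⟩
    · rw [sub_self, abs_zero]; positivity
    · have h1 := (hf (hP x₀)).1 i
      have h2 : P x₀ i ≤ Fintype.card ι / N := by
        simp only [P]
        refine div_le_div_of_nonneg_right ?_ hN'.le
        exact_mod_cast hout x₀ hx₀ i hi
      linarith

/-- Brouwer's fixed point theorem on the standard simplex. -/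
theorem exists_fixedPoint_stdSimplex {ι : Type*} [Fintype ι] [Nonempty ι] (f : (ι → ℝ) → ι → ℝ)
    (hf : Set.MapsTo f (stdSimplex ℝ ι) (stdSimplex ℝ ι))
    (hcont : ContinuousOn f (stdSimplex ℝ ι)) : ∃ q ∈ stdSimplex ℝ ι, f q = q := by
  classical
  obtain ⟨i₀⟩ := ‹Nonempty ι›
  rcases subsingleton_or_nontrivial ι with hι | hι
  · have hq : Pi.single i₀ (1 : ℝ) ∈ stdSimplex ℝ ι := single_mem_stdSimplex ℝ i₀
    refine ⟨_, hq, funext fun i => ?_⟩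
    have h1 := (hf hq).2
    have h2 := hq.2
    have : Unique ι := ⟨⟨i₀⟩, fun _ => Subsingleton.elim _ _⟩
    rw [Fintype.sum_unique] at h1 h2
    rw [Subsingleton.elim i default, h1, h2]
  choose q hq q' hq' hclose hle using fun N : ℕ =>
    exists_approx_le_apply f hf (N + 1) N.succ_pos
  obtain ⟨p, hp, φ, hφ, hlim⟩ := (isCompact_stdSimplex ℝ ι).tendsto_subseq hq
  have hzero : Filter.Tendsto (fun N : ℕ => (Fintype.card ι : ℝ) / ((φ N + 1 : ℕ) : ℝ))
      Filter.atTop (nhds 0) :=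
    ((tendsto_const_div_atTop_nhds_zero_nat (Fintype.card ι : ℝ)).comp
      (Filter.tendsto_add_atTop_nat 1)).comp hφ.tendsto_atTop
  have hlim' : ∀ i, Filter.Tendsto (fun N => q' (φ N) i) Filter.atTop (nhds p) := by
    intro i
    rw [tendsto_pi_nhds] at hlim ⊢
    intro j
    have h0 : Filter.Tendsto (fun N => q' (φ N) i j - q (φ N) j) Filter.atTop (nhds 0) :=
      squeeze_zero_norm (fun N => by rw [Real.norm_eq_abs]; exact hclose (φ N) i j) hzero
    simpa using h0.add (hlim j)
  have hpf : ∀ i, p i ≤ f p i := by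
    intro i
    have h1 : Filter.Tendsto (fun N => f (q' (φ N) i) i) Filter.atTop (nhds (f p i)) := by
      have h2 : Filter.Tendsto (fun N => f (q' (φ N) i)) Filter.atTop (nhds (f p)) :=
        (hcont p hp).tendsto.comp (tendsto_nhdsWithin_iff.2
          ⟨hlim' i, Filter.Eventually.of_forall fun N => hq' (φ N) i⟩)
      exact (tendsto_pi_nhds.1 h2) i
    have h3 : Filter.Tendsto (fun N => q' (φ N) i i - (Fintype.card ι : ℝ) / ((φ N + 1 : ℕ) : ℝ))
        Filter.atTop (nhds (p i)) := by
      simpa using ((tendsto_pi_nhds.1 (hlim' i)) i).sub hzero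
    exact le_of_tendsto_of_tendsto' h3 h1 fun N => hle (φ N) i
  refine ⟨p, hp, funext fun i => ?_⟩
  have hsum : ∑ i, p i = ∑ i, f p i := by rw [hp.2, (hf hp).2]
  exact ((Finset.sum_eq_sum_iff_of_le fun i _ => hpf i).1 hsum i (Finset.mem_univ i)).symm

theorem exists_forall_le_sum_mul {ι : Type*} [Fintype ι] [Nonempty ι] (ζ : (ι → ℝ) → ι → ℝ)
    (hζ : ContinuousOn ζ (stdSimplex ℝ ι)) :
    ∃ q ∈ stdSimplex ℝ ι, ∀ k, ζ q k ≤ ∑ j, q j * ζ q j := by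
  let V : (ι → ℝ) → ℝ := fun q => ∑ j, q j * ζ q j
  let e : (ι → ℝ) → ι → ℝ := fun q k => max 0 (ζ q k - V q)
  have he : ∀ q k, 0 ≤ e q k := fun q k => le_max_left _ _
  have hS : ∀ q, 0 ≤ ∑ k, e q k := fun q => Finset.sum_nonneg fun k _ => he q k
  have hζ' : ∀ k, ContinuousOn (fun q => ζ q k) (stdSimplex ℝ ι) := continuousOn_pi.1 hζ
  have hV : ContinuousOn V (stdSimplex ℝ ι) :=
    continuousOn_finsetSum _ fun j _ => (continuous_apply j).continuousOn.mul (hζ' j)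
  have hec : ∀ k, ContinuousOn (fun q => e q k) (stdSimplex ℝ ι) := fun k =>
    (continuous_const.max continuous_id).comp_continuousOn ((hζ' k).sub hV)
  obtain ⟨q, hq, hfix⟩ := exists_fixedPoint_stdSimplex
    (fun q k => (q k + e q k) / (1 + ∑ j, e q j))
    (fun q hq => by
      refine ⟨fun k => div_nonneg (add_nonneg (hq.1 k) (he q k)) (by linarith [hS q]), ?_⟩
      rw [← Finset.sum_div, Finset.sum_add_distrib, hq.2]
      exact div_self (by linarith [hS q]))
    (continuousOn_pi.2 fun k => ((continuous_apply k).continuousOn.add (hec k)).div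
      (continuousOn_const.add (continuousOn_finsetSum _ fun j _ => hec j))
      fun q _ => by linarith [hS q])
  refine ⟨q, hq, fun k => ?_⟩
  have h1 : ∀ k, e q k = q k * ∑ j, e q j := fun k => by
    have := congrFun hfix k
    rw [div_eq_iff (by linarith [hS q])] at this
    linarith
  have h2 : ∑ k, e q k * e q k = 0 := by
    have h3 : ∀ k, e q k * e q k = (q k * ζ q k - q k * V q) * ∑ j, e q j := fun k => by
      have h4 : e q k * e q k = e q k * (ζ q k - V q) := by
        rcases le_total (ζ q k - V q) 0 with h | h
        · have : e q k = 0 := max_eq_left h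
          simp [this]
        · have : e q k = ζ q k - V q := max_eq_right h
          rw [this]
      rw [h4, h1 k]; ring
    rw [Finset.sum_congr rfl fun k _ => h3 k, ← Finset.sum_mul, Finset.sum_sub_distrib,
      ← Finset.sum_mul, hq.2]
    simp [V]
  have h5 := (Finset.sum_eq_zero_iff_of_nonneg fun k _ => mul_self_nonneg (e q k)).1 h2 k
    (Finset.mem_univ k)
  have h6 : ζ q k - V q ≤ e q k := le_max_right _ _
  rw [mul_self_eq_zero.1 h5] at h6
  exact sub_nonpos.1 h6

theorem exists_mem_convexHull_forall_le_sum_mul {ι E : Type*} [Fintype ι] [Nonempty ι]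
    [NormedAddCommGroup E] [NormedSpace ℝ E] (F : (ι → ℝ) → Set E)
    (hFne : ∀ q ∈ stdSimplex ℝ ι, (F q).Nonempty) (Z : E → ι → ℝ) (hZ : Continuous Z)
    {ε : ℝ} (hε : 0 < ε) :
    ∃ q ∈ stdSimplex ℝ ι,
      ∃ x ∈ convexHull ℝ (⋃ q' ∈ stdSimplex ℝ ι ∩ Metric.ball q ε, F q'),
        ∀ k, Z x k ≤ ∑ j, q j * Z x j := by
  classical
  obtain ⟨t, htΔ, htfin, hcov⟩ := (isCompact_stdSimplex ℝ ι).finite_cover_balls hε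
  lift t to Finset (ι → ℝ) using htfin
  choose! y hy using hFne
  let w : (ι → ℝ) → (ι → ℝ) → ℝ := fun q c => max 0 (ε - dist q c)
  have hw0 : ∀ q c, 0 ≤ w q c := fun q c => le_max_left _ _
  have hwpos : ∀ q c, 0 < w q c → dist q c < ε := fun q c h => by
    rcases lt_max_iff.1 h with h | h
    · exact absurd h (lt_irrefl _)
    · linarith
  have hW : ∀ q ∈ stdSimplex ℝ ι, 0 < ∑ c ∈ t, w q c := fun q hq => by
    obtain ⟨c, hc, hqc⟩ := Set.mem_iUnion₂.1 (hcov hq)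
    refine Finset.sum_pos' (fun c _ => hw0 q c) ⟨c, hc, lt_max_of_lt_right ?_⟩
    linarith [Metric.mem_ball.1 hqc]
  have hwc : ∀ c, Continuous fun q => w q c := fun c => by fun_prop
  let x : (ι → ℝ) → E := fun q => t.centerMass (w q) y
  have hx : ContinuousOn x (stdSimplex ℝ ι) := by
    refine ContinuousOn.smul (ContinuousOn.inv₀ (by fun_prop) fun q hq => (hW q hq).ne') ?_
    exact (continuous_finsetSum _ fun c _ => (hwc c).smul continuous_const).continuousOn
  obtain ⟨q, hq, h⟩ := exists_forall_le_sum_mul (fun q => Z (x q)) (hZ.comp_continuousOn hx)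
  refine ⟨q, hq, x q, ?_, h⟩
  simp only [x]
  rw [← Finset.centerMass_filter_ne_zero]
  refine Finset.centerMass_mem_convexHull _ (fun c _ => hw0 q c) ?_ fun c hc => ?_
  · rw [Finset.sum_filter_ne_zero]; exact hW q hq
  · obtain ⟨hct, hc0⟩ := Finset.mem_filter.1 hc
    refine Set.mem_iUnion₂.2 ⟨c, ⟨htΔ hct, ?_⟩, hy c (htΔ hct)⟩
    rw [Metric.mem_ball, dist_comm]
    exact hwpos q c (lt_of_le_of_ne (hw0 q c) (Ne.symm hc0))

/-- A Kakutani-type variational inequality for a convex-valued correspondence with closed graph on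
the standard simplex. -/
theorem exists_mem_forall_le_sum_mul {ι E : Type*} [Fintype ι] [Nonempty ι]
    [NormedAddCommGroup E] [NormedSpace ℝ E] {K : Set E} (hK : IsCompact K) (hKc : Convex ℝ K)
    (F : (ι → ℝ) → Set E) (hFK : ∀ q ∈ stdSimplex ℝ ι, F q ⊆ K)
    (hFne : ∀ q ∈ stdSimplex ℝ ι, (F q).Nonempty)
    (hFc : ∀ q ∈ stdSimplex ℝ ι, Convex ℝ (F q))
    (hF : ∀ (q : ℕ → ι → ℝ) (x : ℕ → E) (q₀ : ι → ℝ) (x₀ : E), (∀ n, q n ∈ stdSimplex ℝ ι) →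
      (∀ n, x n ∈ F (q n)) → Filter.Tendsto q Filter.atTop (nhds q₀) →
      Filter.Tendsto x Filter.atTop (nhds x₀) → x₀ ∈ F q₀)
    (Z : E → ι → ℝ) (hZ : Continuous Z) :
    ∃ q ∈ stdSimplex ℝ ι, ∃ x ∈ F q, ∀ k, Z x k ≤ ∑ j, q j * Z x j := by
  choose q hq x hx hle using fun n : ℕ =>
    exists_mem_convexHull_forall_le_sum_mul F hFne Z hZ (Nat.one_div_pos_of_nat (α := ℝ) (n := n))
  have hxK : ∀ n, x n ∈ K := fun n =>
    convexHull_min (Set.iUnion₂_subset fun q' hq' => hFK q' hq'.1) hKc (hx n)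
  obtain ⟨⟨p, z⟩, ⟨hp, hz⟩, φ, hφ, hlim⟩ := ((isCompact_stdSimplex ℝ ι).prod hK).tendsto_subseq
    (x := fun n => (q n, x n)) fun n => ⟨hq n, hxK n⟩
  have hlimq : Filter.Tendsto (fun n => q (φ n)) Filter.atTop (nhds p) :=
    (continuous_fst.tendsto _).comp hlim
  have hlimx : Filter.Tendsto (fun n => x (φ n)) Filter.atTop (nhds z) :=
    (continuous_snd.tendsto _).comp hlim
  have huhc : ∀ δ > 0, ∃ η > 0, ∀ q' ∈ stdSimplex ℝ ι, dist q' p < η →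
      F q' ⊆ Metric.thickening δ (F p) := by
    intro δ hδ
    by_contra! h
    choose q' hq' hdist hnot using fun n : ℕ => h _ (Nat.one_div_pos_of_nat (α := ℝ) (n := n))
    choose y hyF hy using fun n => Set.not_subset.1 (hnot n)
    obtain ⟨y₀, -, ψ, hψ, hy₀⟩ := hK.tendsto_subseq fun n => hFK _ (hq' n) (hyF n)
    have hq'lim : Filter.Tendsto q' Filter.atTop (nhds p) :=
      tendsto_iff_dist_tendsto_zero.2 (squeeze_zero (fun _ => dist_nonneg)
        (fun n => (hdist n).le) tendsto_one_div_add_atTop_nhds_zero_nat)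
    have hy₀F : y₀ ∈ F p := hF (q' ∘ ψ) (y ∘ ψ) p y₀ (fun n => hq' _) (fun n => hyF _)
      (hq'lim.comp hψ.tendsto_atTop) hy₀
    have hmem : y₀ ∈ (Metric.thickening δ (F p))ᶜ :=
      Metric.isOpen_thickening.isClosed_compl.mem_of_tendsto hy₀
        (Filter.Eventually.of_forall fun n => hy (ψ n))
    exact hmem (Metric.self_subset_thickening hδ _ hy₀F)
  have hzF : z ∈ F p := by
    have hclosed : IsClosed (F p) := by
      refine isClosed_of_closure_subset fun y hy => ?_
      obtain ⟨s, hs, hlim⟩ := mem_closure_iff_seq_limit.1 hy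
      exact hF (fun _ => p) s p y (fun _ => hp) hs tendsto_const_nhds hlim
    rw [← hclosed.closure_eq, Metric.closure_eq_iInter_cthickening]
    refine Set.mem_iInter₂.2 fun δ hδ => ?_
    refine Metric.closure_thickening_subset_cthickening δ _ (mem_closure_of_tendsto hlimx ?_)
    obtain ⟨η, hη, hsub⟩ := huhc δ hδ
    have h1 : ∀ᶠ n in Filter.atTop, dist (q (φ n)) p < η / 2 :=
      (tendsto_iff_dist_tendsto_zero.1 hlimq).eventually_lt_const (by positivity)
    have h2 : ∀ᶠ n in Filter.atTop, 1 / ((φ n : ℕ) + 1 : ℝ) < η / 2 :=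
      (tendsto_one_div_add_atTop_nhds_zero_nat.comp hφ.tendsto_atTop).eventually_lt_const
        (by positivity)
    filter_upwards [h1, h2] with n hn1 hn2
    refine convexHull_min (Set.iUnion₂_subset fun q' hq' => hsub q' hq'.1 ?_)
      ((hFc p hp).thickening δ) (hx (φ n))
    have := Metric.mem_ball.1 hq'.2
    linarith [dist_triangle q' (q (φ n)) p]
  refine ⟨p, hp, z, hzF, fun k => ?_⟩
  have hZx : ∀ k, Filter.Tendsto (fun n => Z (x (φ n)) k) Filter.atTop (nhds (Z z k)) :=
    tendsto_pi_nhds.1 ((hZ.tendsto z).comp hlimx)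
  exact le_of_tendsto_of_tendsto' (hZx k)
    (tendsto_finsetSum _ fun j _ => ((tendsto_pi_nhds.1 hlimq) j).mul (hZx j)) fun n => hle _ k

theorem dotO_combo {O : Type*} [Fintype O] (r z w : O → ℝ) (s t : ℝ) :
    dotO r (s • z + t • w) = s * dotO r z + t * dotO r w := by
  simp only [dotO, Pi.add_apply, Pi.smul_apply, smul_eq_mul, Finset.mul_sum,
    ← Finset.sum_add_distrib]
  exact Finset.sum_congr rfl fun l _ => by ring

theorem continuous_dotO {O : Type*} [Fintype O] :
    Continuous fun p : (O → ℝ) × (O → ℝ) => dotO p.1 p.2 := by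
  unfold dotO
  fun_prop

theorem continuous_dotIO {I O : Type*} [Fintype I] [Fintype O] (a : I → O → ℝ) :
    Continuous (dotIO a) := by
  unfold dotIO
  fun_prop

theorem sum_dotO_pers {I O C : Type*} [Fintype I] [Fintype O] [Fintype C]
    (a : C → I → O → ℝ) (p : C → ℝ) (x : I → O → ℝ) :
    ∑ i, dotO (pers a p i) (x i) = ∑ c, p c * dotIO (a c) x := by
  simp only [dotO, pers, dotIO, Finset.sum_mul, Finset.mul_sum]
  rw [Finset.sum_comm (s := (univ : Finset C))]
  refine Finset.sum_congr rfl fun i _ => ?_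
  rw [Finset.sum_comm (s := (univ : Finset C))]
  exact Finset.sum_congr rfl fun l _ => Finset.sum_congr rfl fun c _ => by ring

/-- The cheapest bundles among the utility maximizers of the budget set at prices `r` with
unit income. -/
def cheapestDemand {O : Type*} [Fintype O] (u : (O → ℝ) → ℝ) (X : Set (O → ℝ)) (r : O → ℝ) :
    Set (O → ℝ) :=
  {x | x ∈ X ∧ dotO r x ≤ 1 ∧
    ∀ z ∈ X, dotO r z ≤ 1 → u z ≤ u x ∧ (u x ≤ u z → dotO r x ≤ dotO r z)}

theorem cheapestDemand_nonempty {O : Type*} [Fintype O] {u : (O → ℝ) → ℝ} {X : Set (O → ℝ)}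
    (hX : IsCompact X) (hX0 : 0 ∈ X) (hu : ContinuousOn u X) (r : O → ℝ) :
    (cheapestDemand u X r).Nonempty := by
  have hr : Continuous (dotO r) := continuous_dotO.comp (Continuous.prodMk_right r)
  have hB : IsCompact (X ∩ {z | dotO r z ≤ 1}) :=
    hX.inter_right (isClosed_le hr continuous_const)
  have huB : ContinuousOn u (X ∩ {z | dotO r z ≤ 1}) := hu.mono Set.inter_subset_left
  obtain ⟨m, hm, hmax⟩ := hB.exists_isMaxOn ⟨0, hX0, by simp [dotO]⟩ huB
  have hA : IsCompact ((X ∩ {z | dotO r z ≤ 1}) ∩ u ⁻¹' Set.Ici (u m)) :=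
    hB.of_isClosed_subset (huB.preimage_isClosed_of_isClosed hB.isClosed isClosed_Ici)
      Set.inter_subset_left
  obtain ⟨x, ⟨⟨hxX, hxr⟩, hxu⟩, hmin⟩ :=
    hA.exists_isMinOn ⟨m, hm, (le_refl (u m) : u m ≤ u m)⟩ hr.continuousOn
  exact ⟨x, hxX, hxr, fun z hz hzr => ⟨(hmax ⟨hz, hzr⟩ : u z ≤ u m).trans hxu,
    fun h => hmin ⟨⟨hz, hzr⟩, le_trans hxu h⟩⟩⟩

theorem convex_cheapestDemand {O : Type*} [Fintype O] {u : (O → ℝ) → ℝ} {X : Set (O → ℝ)}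
    (hXc : Convex ℝ X) (hqc : ∀ z ∈ X, ∀ w ∈ X, ∀ t : ℝ, 0 ≤ t → t ≤ 1 →
      min (u z) (u w) ≤ u (t • z + (1 - t) • w)) (r : O → ℝ) :
    Convex ℝ (cheapestDemand u X r) := by
  rintro x ⟨hx, hxr, hxu⟩ y ⟨hy, hyr, hyu⟩ s t hs ht hst
  obtain rfl : t = 1 - s := by linarith
  have huxy : u x = u y := le_antisymm (hyu x hx hxr).1 (hxu y hy hyr).1
  have hrxy : dotO r x = dotO r y :=
    le_antisymm ((hxu y hy hyr).2 huxy.le) ((hyu x hx hxr).2 huxy.ge)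
  have hr : dotO r (s • x + (1 - s) • y) = dotO r x := by
    rw [dotO_combo, ← hrxy]; ring
  have hu := hqc x hx y hy s hs (by linarith)
  rw [← huxy, min_self] at hu
  refine ⟨hXc hx hy hs ht hst, hr.trans_le hxr, fun z hz hzr =>
    ⟨(hxu z hz hzr).1.trans hu, fun h => hr.trans_le ((hxu z hz hzr).2 (hu.trans h))⟩⟩

theorem exists_combo_affordable {O : Type*} [Fintype O] (r z w : O → ℝ) (h : dotO r z < 1) :
    ∃ t : ℝ, 0 < t ∧ t < 1 ∧ dotO r (t • w + (1 - t) • z) < 1 := by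
  have hcont : Filter.Tendsto (fun t : ℝ => t * dotO r w + (1 - t) * dotO r z)
      (nhdsWithin 0 (Set.Ioi 0)) (nhds (dotO r z)) := by
    have : Continuous fun t : ℝ => t * dotO r w + (1 - t) * dotO r z := by fun_prop
    simpa using (this.tendsto 0).mono_left nhdsWithin_le_nhds
  obtain ⟨t, ht, ht'⟩ := ((hcont.eventually_lt_const h).and
    (Ioo_mem_nhdsGT (zero_lt_one' ℝ))).exists
  exact ⟨t, ht'.1, ht'.2, by rwa [dotO_combo]⟩

theorem mem_cheapestDemand_of_tendsto {O : Type*} [Fintype O] {u : (O → ℝ) → ℝ}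
    {X : Set (O → ℝ)} (hX : IsClosed X) (hXc : Convex ℝ X) (hX0 : 0 ∈ X) (hu : ContinuousOn u X)
    (hss : ∀ z ∈ X, ∀ w ∈ X, ∀ t : ℝ, 0 < t → t < 1 → u z ≠ u w →
      min (u z) (u w) < u (t • z + (1 - t) • w))
    {r : ℕ → O → ℝ} {x : ℕ → O → ℝ} {r₀ x₀ : O → ℝ} (hx : ∀ n, x n ∈ cheapestDemand u X (r n))
    (hr₀ : Filter.Tendsto r Filter.atTop (nhds r₀))
    (hx₀ : Filter.Tendsto x Filter.atTop (nhds x₀)) : x₀ ∈ cheapestDemand u X r₀ := by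
  have hx₀X : x₀ ∈ X := hX.mem_of_tendsto hx₀ (Filter.Eventually.of_forall fun n => (hx n).1)
  have hcost : Filter.Tendsto (fun n => dotO (r n) (x n)) Filter.atTop (nhds (dotO r₀ x₀)) :=
    (continuous_dotO.tendsto (r₀, x₀)).comp (hr₀.prodMk_nhds hx₀)
  have hcostz : ∀ z, Filter.Tendsto (fun n => dotO (r n) z) Filter.atTop (nhds (dotO r₀ z)) :=
    fun z => (continuous_dotO.tendsto (r₀, z)).comp (hr₀.prodMk_nhds tendsto_const_nhds)
  have hux : Filter.Tendsto (fun n => u (x n)) Filter.atTop (nhds (u x₀)) :=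
    (hu x₀ hx₀X).tendsto.comp (tendsto_nhdsWithin_iff.2
      ⟨hx₀, Filter.Eventually.of_forall fun n => (hx n).1⟩)
  have hlt : ∀ z ∈ X, dotO r₀ z < 1 → u z ≤ u x₀ := fun z hz hzr =>
    ge_of_tendsto hux (((hcostz z).eventually_lt_const hzr).mono fun n hn =>
      ((hx n).2.2 z hz hn.le).1)
  have hmax : ∀ z ∈ X, dotO r₀ z ≤ 1 → u z ≤ u x₀ := by
    intro z hz hzr
    have hmem : ∀ t ∈ Set.Ioo (0 : ℝ) 1, t • z ∈ X := fun t ht => by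
      simpa using hXc hz hX0 ht.1.le (sub_nonneg.2 ht.2.le) (by ring)
    have hev : ∀ᶠ t in nhdsWithin (1 : ℝ) (Set.Iio 1), t ∈ Set.Ioo (0 : ℝ) 1 :=
      Ioo_mem_nhdsLT (zero_lt_one' ℝ)
    have hlim : Filter.Tendsto (fun t : ℝ => u (t • z)) (nhdsWithin 1 (Set.Iio 1))
        (nhds (u z)) := by
      refine (hu z hz).tendsto.comp (tendsto_nhdsWithin_iff.2 ⟨?_, hev.mono hmem⟩)
      have : Continuous fun t : ℝ => t • z := by fun_prop
      simpa using (this.tendsto 1).mono_left nhdsWithin_le_nhds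
    refine le_of_tendsto hlim (hev.mono fun t ht => hlt _ (hmem t ht) ?_)
    have := dotO_combo r₀ z 0 t 0
    simp only [smul_zero, add_zero, zero_mul] at this
    rw [this]
    nlinarith [ht.1, ht.2]
  refine ⟨hx₀X, le_of_tendsto' hcost fun n => (hx n).2.1, fun z hz hzr =>
    ⟨hmax z hz hzr, fun hxz => ?_⟩⟩
  by_contra! hcheap
  have hr1 : dotO r₀ x₀ ≤ 1 := le_of_tendsto' hcost fun n => (hx n).2.1
  have hz1 : dotO r₀ z < 1 := hcheap.trans_le hr1
  have hzx : u z = u x₀ := le_antisymm (hmax z hz hzr) hxz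
  by_cases hsat : ∃ w ∈ X, u x₀ < u w
  · obtain ⟨w, hw, hwu⟩ := hsat
    obtain ⟨t, ht0, ht1, ht⟩ := exists_combo_affordable r₀ z w hz1
    have h1 := hss w hw z hz t ht0 ht1 (by rw [hzx]; exact hwu.ne')
    rw [hzx, min_eq_right hwu.le] at h1
    exact absurd (hlt _ (hXc hw hz ht0.le (sub_nonneg.2 ht1.le) (by ring)) ht) (not_le.2 h1)
  · push Not at hsat
    refine not_le.2 hcheap (le_of_tendsto_of_tendsto hcost (hcostz z) ?_)
    filter_upwards [(hcostz z).eventually_lt_const hz1] with n hn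
    exact ((hx n).2.2 z hz hn.le).2 ((hsat _ (hx n).1).trans hxz)

/-- Anything weakly better than a cheapest demanded bundle costs at least as much. -/
theorem le_dotO_of_mem_cheapestDemand {O : Type*} [Fintype O] {u : (O → ℝ) → ℝ}
    {X : Set (O → ℝ)} {r x y : O → ℝ} (hx : x ∈ cheapestDemand u X r) (hy : y ∈ X)
    (hxy : u x ≤ u y) : dotO r x ≤ dotO r y := by
  by_contra! h
  exact not_le.2 h ((hx.2.2 y hy (h.le.trans hx.2.1)).2 hxy)

theorem dotO_lt_of_mem_cheapestDemand {O : Type*} [Fintype O] {u : (O → ℝ) → ℝ}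
    {X : Set (O → ℝ)} {r x y : O → ℝ} (hx : x ∈ cheapestDemand u X r) (hy : y ∈ X)
    (hxy : u x < u y) : dotO r x < dotO r y := by
  by_contra! h
  exact not_le.2 hxy (hx.2.2 y hy (h.trans hx.2.1)).1

theorem statement2 {I O C : Type*} [Fintype I] [Fintype O] [Fintype C]
    [Nonempty I] [Nonempty O]
    (S : Finset (I → O → ℝ)) (hSne : S.Nonempty)
    (𝒞 : Set (I → O → ℝ)) (h𝒞 : 𝒞 = convexHull ℝ (S : Set (I → O → ℝ)))
    (h𝒞nn : ∀ x ∈ 𝒞, ∀ i l, 0 ≤ x i l)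
    (X : I → Set (O → ℝ))
    (hXnn : ∀ i, ∀ z ∈ X i, ∀ l, 0 ≤ z l)
    (hXcpt : ∀ i, IsCompact (X i))
    (hXcvx : ∀ i, Convex ℝ (X i))
    (hX0 : ∀ i, (0 : O → ℝ) ∈ X i)
    (hXdc : ∀ i, ∀ y z : O → ℝ, (∀ l, 0 ≤ y l) → (∀ l, y l ≤ z l) → z ∈ X i → y ∈ X i)
    (a : C → I → O → ℝ) (b : C → ℝ)
    (ha : ∀ c i l, 0 ≤ a c i l) (hb : ∀ c, 0 < b c)
    (hlcs : {x : I → O → ℝ | (∀ i l, 0 ≤ x i l) ∧ ∃ x' ∈ 𝒞, ∀ i l, x i l ≤ x' i l}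
      = {x : I → O → ℝ | (∀ i l, 0 ≤ x i l) ∧ (∀ i, x i ∈ X i) ∧ ∀ c, dotIO (a c) x ≤ b c})
    (u : I → (O → ℝ) → ℝ)
    (hu_cont : ∀ i, ContinuousOn (u i) {z : O → ℝ | ∀ l, 0 ≤ z l})
    (hu_qc : ∀ i, ∀ z ∈ {z : O → ℝ | ∀ l, 0 ≤ z l}, ∀ w ∈ {z : O → ℝ | ∀ l, 0 ≤ z l},
      ∀ t : ℝ, 0 ≤ t → t ≤ 1 → min (u i z) (u i w) ≤ u i (t • z + (1 - t) • w))
    (hu_ssqc : ∀ i, ∀ z ∈ {z : O → ℝ | ∀ l, 0 ≤ z l}, ∀ w ∈ {z : O → ℝ | ∀ l, 0 ≤ z l},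
      ∀ t : ℝ, 0 < t → t < 1 → u i z ≠ u i w →
        min (u i z) (u i w) < u i (t • z + (1 - t) • w))
    (hu_mono : ∀ i, ∀ z ∈ {z : O → ℝ | ∀ l, 0 ≤ z l}, ∀ w ∈ {z : O → ℝ | ∀ l, 0 ≤ z l},
      (∀ l, w l ≤ z l) → w ≠ z → u i w < u i z)
    :
    ∃ (x : I → O → ℝ) (p : C → ℝ),
      (∀ c, 0 ≤ p c) ∧
      (∀ i, x i ∈ X i ∧ dotO (pers a p i) (x i) ≤ 1 ∧
        ∀ z ∈ X i, dotO (pers a p i) z ≤ 1 → u i z ≤ u i (x i)) ∧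
      x ∈ 𝒞 ∧
      (∀ c, dotIO (a c) x < b c → p c = 0) ∧
      (¬ ∃ y ∈ 𝒞, (∀ i, u i (x i) ≤ u i (y i)) ∧ ∃ j, u j (x j) < u j (y j)) := by
  classical
  have hpos : ∀ c q, 0 ≤ q → 0 ≤ (Fintype.card I : ℝ) * q / b c := fun c q hq =>
    div_nonneg (mul_nonneg (Nat.cast_nonneg _) hq) (hb c).le
  have hN : (0 : ℝ) < Fintype.card I := by exact_mod_cast Fintype.card_pos
  have huX : ∀ i, ContinuousOn (u i) (X i) := fun i => (hu_cont i).mono (hXnn i)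
  let price : (Option C → ℝ) → C → ℝ := fun q c => Fintype.card I * q (some c) / b c
  have hprice : ∀ i, Continuous fun q => pers a (price q) i := fun i => by
    refine continuous_pi fun l => ?_
    simp only [pers, price]
    fun_prop
  let F : (Option C → ℝ) → Set (I → O → ℝ) := fun q =>
    {x | ∀ i, x i ∈ cheapestDemand (u i) (X i) (pers a (price q) i)}
  let Z : (I → O → ℝ) → Option C → ℝ := fun x o => o.elim 0 fun c => dotIO (a c) x / b c - 1
  have hZ : Continuous Z := continuous_pi fun o => by
    cases o with
    | none => exact continuous_const
    | some c => exact ((continuous_dotIO (a c)).div_const _).sub continuous_const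
  obtain ⟨q, hq, x, hxF, hle⟩ := exists_mem_forall_le_sum_mul
    (isCompact_univ_pi hXcpt) (convex_pi fun i _ => hXcvx i) F
    (fun q _ x hx i _ => (hx i).1)
    (fun q _ => by
      choose x hx using fun i => cheapestDemand_nonempty (hXcpt i) (hX0 i) (huX i)
        (pers a (price q) i)
      exact ⟨x, hx⟩)
    (fun q _ x hx y hy s t hs ht hst i => convex_cheapestDemand (hXcvx i)
      (fun z hz w hw => hu_qc i z (hXnn i z hz) w (hXnn i w hw)) _ (hx i) (hy i) hs ht hst)
    (fun q x q₀ x₀ _ hx hq hx₀ i => mem_cheapestDemand_of_tendsto (hXcpt i).isClosed (hXcvx i)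
      (hX0 i) (huX i) (fun z hz w hw => hu_ssqc i z (hXnn i z hz) w (hXnn i w hw))
      (fun n => hx n i) (((hprice i).tendsto q₀).comp hq) (tendsto_pi_nhds.1 hx₀ i))
    Z hZ
  set p := price q with hp
  set V := ∑ j, q j * Z x j with hV
  have hp0 : ∀ c, 0 ≤ p c := fun c => hpos c _ (hq.1 _)
  have hslack : ∀ k, q k * (V - Z x k) = 0 := by
    have hsum : ∑ k, q k * (V - Z x k) = 0 := by
      simp only [mul_sub, Finset.sum_sub_distrib, ← Finset.sum_mul, hq.2, one_mul]
      exact sub_self _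
    intro k
    exact (Finset.sum_eq_zero_iff_of_nonneg fun k _ =>
      mul_nonneg (hq.1 k) (sub_nonneg.2 (hle k))).1 hsum k (Finset.mem_univ k)
  have hV0 : 0 ≤ V := hle none
  have hbp : ∀ c, Fintype.card I * (q (some c) * Z x (some c)) =
      p c * dotIO (a c) x - Fintype.card I * q (some c) := fun c => by
    have := (hb c).ne'
    simp only [hp, price, Z, Option.elim]
    field_simp
  have hwalras : V ≤ q none := by
    have h1 : Fintype.card I * V = ∑ i, dotO (pers a p i) (x i) -
        Fintype.card I * ∑ c, q (some c) := by
      rw [hV, Fintype.sum_option, sum_dotO_pers, Finset.mul_sum, ← Finset.sum_sub_distrib,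
        ← Finset.sum_congr rfl fun c _ => hbp c, ← Finset.mul_sum]
      simp [Z]
    have h2 : ∑ i, dotO (pers a p i) (x i) ≤ Fintype.card I := by
      simpa using Finset.sum_le_sum fun i (_ : i ∈ univ) => (hxF i).2.1
    have h3 := hq.2
    rw [Fintype.sum_option] at h3
    have h4 : ∑ c, q (some c) = 1 - q none := by linarith
    rw [h4] at h1
    nlinarith
  have hV00 : V = 0 := by
    have h1 : q none * (V - 0) = 0 := hslack none
    rw [sub_zero] at h1
    rcases mul_eq_zero.1 h1 with h | h
    · exact le_antisymm (hwalras.trans_eq h) hV0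
    · exact h
  have hfeas : ∀ c, dotIO (a c) x ≤ b c := fun c => by
    have h1 : dotIO (a c) x / b c - 1 ≤ V := hle (some c)
    rw [hV00, sub_nonpos, div_le_one (hb c)] at h1
    exact h1
  have hcs : ∀ c, dotIO (a c) x < b c → p c = 0 := fun c hc => by
    have h1 : q (some c) * (V - (dotIO (a c) x / b c - 1)) = 0 := hslack (some c)
    rcases mul_eq_zero.1 h1 with h | h
    · simp [hp, price, h]
    · rw [hV00, zero_sub, neg_eq_zero, sub_eq_zero, div_eq_one_iff_eq (hb c).ne'] at h
      exact absurd h hc.ne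
  have hcost : ∀ y, (∀ c, dotIO (a c) y ≤ b c) →
      ∑ i, dotO (pers a p i) (y i) ≤ ∑ i, dotO (pers a p i) (x i) := by
    intro y hy
    rw [sum_dotO_pers, sum_dotO_pers]
    refine Finset.sum_le_sum fun c _ => ?_
    rcases (hfeas c).lt_or_eq with h | h
    · simp [hcs c h]
    · rw [h]; exact mul_le_mul_of_nonneg_left (hy c) (hp0 c)
  have hmem : ∀ y ∈ 𝒞, (∀ i, y i ∈ X i) ∧ ∀ c, dotIO (a c) y ≤ b c := fun y hy => by
    have : y ∈ {x : I → O → ℝ | (∀ i l, 0 ≤ x i l) ∧ ∃ x' ∈ 𝒞, ∀ i l, x i l ≤ x' i l} :=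
      ⟨h𝒞nn y hy, y, hy, fun _ _ => le_rfl⟩
    rw [hlcs] at this
    exact this.2
  have hxnn : ∀ i l, 0 ≤ x i l := fun i => hXnn i _ (hxF i).1
  have hnodom : ∀ y ∈ 𝒞, (∀ i, u i (x i) ≤ u i (y i)) → ∀ j, ¬ u j (x j) < u j (y j) := by
    intro y hy hall j hj
    refine not_lt.2 (hcost y (hmem y hy).2) (Finset.sum_lt_sum (fun i _ => ?_)
      ⟨j, Finset.mem_univ j, ?_⟩)
    · exact le_dotO_of_mem_cheapestDemand (hxF i) ((hmem y hy).1 i) (hall i)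
    · exact dotO_lt_of_mem_cheapestDemand (hxF j) ((hmem y hy).1 j) hj
  have hx𝒞 : x ∈ 𝒞 := by
    have : x ∈ {x : I → O → ℝ | (∀ i l, 0 ≤ x i l) ∧ ∃ x' ∈ 𝒞, ∀ i l, x i l ≤ x' i l} := by
      rw [hlcs]
      exact ⟨hxnn, fun i => (hxF i).1, hfeas⟩
    obtain ⟨-, x', hx', hxx'⟩ := this
    have hlt : ∀ i, x i ≠ x' i → u i (x i) < u i (x' i) := fun i hi =>
      hu_mono i _ (h𝒞nn x' hx' i) _ (hxnn i) (hxx' i) hi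
    have heq : x = x' := by
      by_contra hne
      obtain ⟨j, hj⟩ := Function.ne_iff.1 hne
      refine hnodom x' hx' (fun i => ?_) j (hlt j hj)
      by_cases hi : x i = x' i
      · rw [hi]
      · exact (hlt i hi).le
    rwa [heq]
  refine ⟨x, p, hp0, fun i => ⟨(hxF i).1, (hxF i).2.1, fun z hz hzr => ((hxF i).2.2 z hz hzr).1⟩,
    hx𝒞, hcs, ?_⟩
  rintro ⟨y, hy, hall, j, hj⟩
  exact hnodom y hy hall j hj
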